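/- arXiv:1411.0437 — 10 statements merged into one kernel-verified Lean document; each statement's English description precedes it below -/
import Mathlib

section
/- Let M, N ≥ 1, let γ_A be a real symmetric positive definite 2M×2M matrix, γ_B a real symmetric 2N×2N matrix, and C a real 2M×2N matrix, and let γ be the (2M+2N)×(2M+2N) block matrix [[γ_A, C], [Cᵀ, γ_B]]. Then the complex Hermitian matrix γ + i·(0_{2M} ⊕ Ω_N) is positive semidefinite if and only if the complex Hermitian matrix (γ_B − Cᵀ γ_A⁻¹ C) + i·Ω_N is positive semidefinite. -/
open Matrix ComplexOrder

/-- The `2N × 2N` symplectic form: the direct sum of `N` copies of `[[0,1],[-1,0]]`. -/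
def Omega (N : ℕ) : Matrix (Fin (2 * N)) (Fin (2 * N)) ℝ :=
  Matrix.of fun i j =>
    if i.val / 2 = j.val / 2 then
      if i.val % 2 = 0 ∧ j.val % 2 = 1 then 1
      else if i.val % 2 = 1 ∧ j.val % 2 = 0 then -1
      else 0
    else 0

/-- The complex matrix `S + i·Ω` obtained from real matrices `S` and `Ω`. -/
noncomputable def addI {n : Type*} (S Om : Matrix n n ℝ) : Matrix n n ℂ :=
  S.map (fun x => (x : ℂ)) + Complex.I • Om.map (fun x => (x : ℂ))

section

variable {m n : Type*}

theorem Matrix.map_ofReal_inv [Fintype m] [DecidableEq m] {A : Matrix m m ℝ} (hA : IsUnit A) :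
    A⁻¹.map (fun x => (x : ℂ)) = (A.map (fun x => (x : ℂ)))⁻¹ := by
  refine (Matrix.inv_eq_left_inv ?_).symm
  have h := congrArg (Complex.ofRealHom.mapMatrix)
    (Matrix.nonsing_inv_mul A ((Matrix.isUnit_iff_isUnit_det A).mp hA))
  rwa [map_mul, map_one] at h

open scoped MatrixOrder in
/-- The complexification of a real positive definite matrix is positive definite. -/
theorem Matrix.PosDef.map_ofReal [Fintype m] [DecidableEq m] {A : Matrix m m ℝ} (hA : A.PosDef) :
    (A.map (fun x => (x : ℂ))).PosDef := by
  obtain ⟨B, rfl⟩ := CStarAlgebra.nonneg_iff_eq_star_mul_self.mp hA.posSemidef.nonneg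
  have hmul : (star B * B).map (fun x => (x : ℂ)) =
      (B.map (fun x => (x : ℂ)))ᴴ * B.map (fun x => (x : ℂ)) := by
    ext i j
    simp [Matrix.mul_apply, star_eq_conjTranspose]
  have hps : ((star B * B).map (fun x => (x : ℂ))).PosSemidef :=
    hmul ▸ posSemidef_conjTranspose_mul_self _
  exact hps.posDef_iff_isUnit.mpr (hA.isUnit.map Complex.ofRealHom.mapMatrix)

theorem addI_fromBlocks (A : Matrix m m ℝ) (C : Matrix m n ℝ) (B Om : Matrix n n ℝ) :
    addI (fromBlocks A C Cᵀ B) (fromBlocks 0 0 0 Om) =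
      fromBlocks (A.map (fun x => (x : ℂ))) (C.map (fun x => (x : ℂ)))
        (C.map (fun x => (x : ℂ)))ᴴ (addI B Om) := by
  ext (i | i) (j | j) <;> simp [addI]

theorem addI_sub (A B Om : Matrix n n ℝ) :
    addI (A - B) Om = addI A Om - B.map (fun x => (x : ℂ)) := by
  ext i j
  simp only [addI, Matrix.add_apply, Matrix.sub_apply, map_apply, Complex.ofReal_sub]
  ring

theorem map_ofReal_transpose_mul_inv_mul [Fintype m] [DecidableEq m] {A : Matrix m m ℝ}
    (hA : IsUnit A) (C : Matrix m n ℝ) :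
    (Cᵀ * A⁻¹ * C).map (fun x => (x : ℂ)) =
      (C.map (fun x => (x : ℂ)))ᴴ * (A.map (fun x => (x : ℂ)))⁻¹ * C.map (fun x => (x : ℂ)) := by
  rw [← Matrix.map_ofReal_inv hA]
  ext i j
  simp [Matrix.mul_apply]

end

/-- the Wiseman–Jones–Doherty non-steerability condition
`γ + i·(0_A ⊕ Ω_B) ≥ 0` is equivalent to the Schur-complement condition
`(γ_B − Cᵀ γ_A⁻¹ C) + i·Ω_B ≥ 0`. -/
theorem schur_complement_steering_criterion (M N : ℕ) (hM : 1 ≤ M) (hN : 1 ≤ N)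
    (γA : Matrix (Fin (2 * M)) (Fin (2 * M)) ℝ)
    (γB : Matrix (Fin (2 * N)) (Fin (2 * N)) ℝ)
    (C : Matrix (Fin (2 * M)) (Fin (2 * N)) ℝ)
    (hA : γA.PosDef) (hAs : γA.IsSymm) (hBs : γB.IsSymm) :
    (addI (Matrix.fromBlocks γA C Cᵀ γB)
        (Matrix.fromBlocks 0 0 0 (Omega N))).PosSemidef ↔
      (addI (γB - Cᵀ * γA⁻¹ * C) (Omega N)).PosSemidef := by
  have hAc := hA.map_ofReal
  have := hAc.isUnit.invertible
  rw [addI_fromBlocks, addI_sub, map_ofReal_transpose_mul_inv_mul hA.isUnit,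
    PosDef.fromBlocks₁₁ _ _ hAc]
end

section
/- Let N ≥ 1 and let S be a real symmetric 2N×2N matrix such that the complex Hermitian matrix S + i·Ω_N is positive semidefinite. Then det S ≥ 1. -/
open Matrix ComplexOrder

/-- If `-A ≤ K ≤ A` with `A` positive definite and `K` Hermitian, then `|det K| ≤ |det A|`. -/
lemma norm_det_le_of_posSemidef_add_sub {n : Type*} [Fintype n] [DecidableEq n]
    {A K : Matrix n n ℂ} (hA : A.PosDef) (hK : K.IsHermitian)
    (hadd : (A + K).PosSemidef) (hsub : (A - K).PosSemidef) :
    ‖K.det‖ ≤ ‖A.det‖ := by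
  obtain ⟨B, hB, rfl⟩ : ∃ B : Matrix n n ℂ, IsUnit B ∧ A = Bᴴ * B := by
    open scoped MatrixOrder in
    exact CStarAlgebra.isStrictlyPositive_iff_eq_star_mul_self.mp hA.isStrictlyPositive
  have hdet : IsUnit B.det := (Matrix.isUnit_iff_isUnit_det B).mp hB
  set C : Matrix n n ℂ := B⁻¹ᴴ * K * B⁻¹ with hCdef
  have hone : B⁻¹ᴴ * (Bᴴ * B) * B⁻¹ = 1 := by
    rw [← Matrix.mul_assoc, ← Matrix.conjTranspose_mul, Matrix.mul_nonsing_inv _ hdet,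
      Matrix.conjTranspose_one, Matrix.one_mul, Matrix.mul_nonsing_inv _ hdet]
  have hKC : K = Bᴴ * C * B := by
    have hstar : Bᴴ * B⁻¹ᴴ = 1 := by
      rw [← Matrix.conjTranspose_mul, Matrix.nonsing_inv_mul _ hdet, Matrix.conjTranspose_one]
    calc K = (Bᴴ * B⁻¹ᴴ) * K * (B⁻¹ * B) := by
          rw [hstar, Matrix.nonsing_inv_mul _ hdet, Matrix.one_mul, Matrix.mul_one]
      _ = Bᴴ * C * B := by simp only [hCdef, Matrix.mul_assoc]
  have hC : C.IsHermitian := Matrix.isHermitian_conjTranspose_mul_mul _ hK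
  have hCadd : (1 + C).PosSemidef := by
    have := hadd.conjTranspose_mul_mul_same B⁻¹
    rwa [Matrix.mul_add, Matrix.add_mul, hone] at this
  have hCsub : (1 - C).PosSemidef := by
    have := hsub.conjTranspose_mul_mul_same B⁻¹
    rwa [Matrix.mul_sub, Matrix.sub_mul, hone] at this
  have heig (i : n) : ‖(hC.eigenvalues i : ℂ)‖ ≤ 1 := by
    let v : n → ℂ := hC.eigenvectorBasis i
    have hv : star v ⬝ᵥ v = 1 := by
      have := hC.eigenvectorBasis.orthonormal.1 i
      have h2 := inner_self_eq_norm_sq_to_K (𝕜 := ℂ) (hC.eigenvectorBasis i)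
      rw [this, EuclideanSpace.inner_eq_star_dotProduct, dotProduct_comm] at h2
      simpa using h2
    have hCv : C *ᵥ v = (hC.eigenvalues i : ℂ) • v := by
      simpa using hC.mulVec_eigenvectorBasis i
    have h1 := hCadd.dotProduct_mulVec_nonneg v
    have h2 := hCsub.dotProduct_mulVec_nonneg v
    rw [Matrix.add_mulVec, hCv, Matrix.one_mulVec, dotProduct_add, dotProduct_smul, hv] at h1
    rw [Matrix.sub_mulVec, hCv, Matrix.one_mulVec, dotProduct_sub, dotProduct_smul, hv] at h2
    simp only [smul_eq_mul, mul_one] at h1 h2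
    have h1' : 0 ≤ 1 + hC.eigenvalues i := by exact_mod_cast h1
    have h2' : 0 ≤ 1 - hC.eigenvalues i := by exact_mod_cast h2
    rw [Complex.norm_real, Real.norm_eq_abs, abs_le]
    constructor <;> linarith
  have hCdet : ‖C.det‖ ≤ 1 := by
    rw [hC.det_eq_prod_eigenvalues, norm_prod]
    exact Finset.prod_le_one (fun _ _ => norm_nonneg _) fun i _ => heig i
  rw [hKC]
  simp only [Matrix.det_mul, norm_mul]
  calc ‖Bᴴ.det‖ * ‖C.det‖ * ‖B.det‖ = ‖Bᴴ.det‖ * ‖B.det‖ * ‖C.det‖ := by ring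
    _ ≤ ‖Bᴴ.det‖ * ‖B.det‖ := mul_le_of_le_one_right (by positivity) hCdet

lemma Omega_transpose (N : ℕ) : (Omega N)ᵀ = -Omega N := by
  ext i j
  simp only [Omega, Matrix.transpose_apply, Matrix.neg_apply, Matrix.of_apply]
  grind

lemma Omega_mul_self (N : ℕ) : Omega N * Omega N = -1 := by
  ext i j
  have hp : 2 * (i.val / 2) + (1 - i.val % 2) < 2 * N := by omega
  rw [Matrix.mul_apply, Finset.sum_eq_single ⟨2 * (i.val / 2) + (1 - i.val % 2), hp⟩]
  · simp only [Omega, Matrix.of_apply, Matrix.neg_apply, Matrix.one_apply, Fin.ext_iff]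
    rcases Nat.mod_two_eq_zero_or_one i.val with hi | hi <;>
      rcases Nat.mod_two_eq_zero_or_one j.val with hj | hj <;> grind
  · intro k _ hk
    have hk' : k.val ≠ 2 * (i.val / 2) + (1 - i.val % 2) := fun e => hk (Fin.ext e)
    have : Omega N i k = 0 := by
      simp only [Omega, Matrix.of_apply]
      grind
    rw [this, zero_mul]
  · simp

/-- a real symmetric matrix satisfying the uncertainty relation
`S + i·Ω_N ≥ 0` has determinant at least `1`. -/
theorem det_ge_one_of_uncertainty (N : ℕ) (hN : 1 ≤ N)
    (S : Matrix (Fin (2 * N)) (Fin (2 * N)) ℝ) (hS : S.IsSymm)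
    (h : (addI S (Omega N)).PosSemidef) :
    1 ≤ S.det := by
  set A : Matrix (Fin (2 * N)) (Fin (2 * N)) ℂ := S.map (fun x => (x : ℂ)) with hA
  set W : Matrix (Fin (2 * N)) (Fin (2 * N)) ℂ := (Omega N).map (fun x => (x : ℂ)) with hW
  have hWW : W * W = -1 := by
    have hmap : W = (Omega N).map Complex.ofRealHom := rfl
    rw [hmap, ← Matrix.map_mul, Omega_mul_self]
    simp [Matrix.map_neg]
  have hWT : Wᵀ = -W := by
    rw [hW, ← Matrix.transpose_map, Omega_transpose]
    ext; simp
  have hAT : Aᵀ = A := by rw [hA, ← Matrix.transpose_map, hS.eq]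
  have hKK : (Complex.I • W) * (Complex.I • W) = 1 := by
    rw [Matrix.smul_mul, Matrix.mul_smul, smul_smul, hWW]
    simp
  have hadd : (A + Complex.I • W).PosSemidef := h
  have hsub : (A - Complex.I • W).PosSemidef := by
    have := hadd.transpose
    rwa [Matrix.transpose_add, Matrix.transpose_smul, hWT, hAT, smul_neg,
      ← sub_eq_add_neg] at this
  have hK : (Complex.I • W).IsHermitian := by
    have hWH : Wᴴ = -W := by
      rw [← hWT]; ext; simp [hW]
    simp [Matrix.IsHermitian, hWH]
  have hAH : A.IsHermitian := by
    have : Aᴴ = Aᵀ := by ext; simp [hA]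
    rw [Matrix.IsHermitian, this, hAT]
  have hApos : A.PosDef := by
    refine .of_dotProduct_mulVec_pos hAH fun v hv => ?_
    have h1 := hadd.dotProduct_mulVec_nonneg v
    have h2 := hsub.dotProduct_mulVec_nonneg v
    have hsum : (2 : ℂ) * (star v ⬝ᵥ A *ᵥ v) =
        star v ⬝ᵥ (A + Complex.I • W) *ᵥ v + star v ⬝ᵥ (A - Complex.I • W) *ᵥ v := by
      simp only [Matrix.add_mulVec, Matrix.sub_mulVec, dotProduct_add, dotProduct_sub]
      ring
    have hnn : 0 ≤ star v ⬝ᵥ A *ᵥ v := by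
      have := add_nonneg h1 h2
      rw [← hsum] at this
      simpa [Complex.nonneg_iff, eq_comm] using this
    refine lt_of_le_of_ne hnn fun h0 => hv ?_
    rw [← h0, mul_zero] at hsum
    obtain ⟨e1, e2⟩ := (add_eq_zero_iff_of_nonneg h1 h2).mp hsum.symm
    rw [hadd.dotProduct_mulVec_zero_iff] at e1
    rw [hsub.dotProduct_mulVec_zero_iff] at e2
    have e3 : (Complex.I • W) *ᵥ v = 0 := by
      rw [Matrix.add_mulVec] at e1
      rw [Matrix.sub_mulVec] at e2
      have := sub_eq_zero.mpr (e1.trans e2.symm)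
      rw [add_sub_sub_cancel, ← two_smul ℂ] at this
      exact (smul_eq_zero.mp this).resolve_left two_ne_zero
    rw [← Matrix.one_mulVec v, ← hKK, ← Matrix.mulVec_mulVec, e3, Matrix.mulVec_zero]
  have hKdet : ‖(Complex.I • W).det‖ = 1 := by
    have := congrArg (fun M => ‖M.det‖) hKK
    simp only [Matrix.det_mul, norm_mul, Matrix.det_one, norm_one] at this
    nlinarith [norm_nonneg (Complex.I • W).det]
  have hAdet : A.det = (S.det : ℂ) := (RingHom.map_det Complex.ofRealHom S).symm
  have hSpos : 0 < S.det := by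
    have := hApos.det_pos
    rw [hAdet] at this
    exact_mod_cast this
  have hle := norm_det_le_of_posSemidef_add_sub hApos hK hadd hsub
  rwa [hKdet, hAdet, Complex.norm_real, Real.norm_of_nonneg hSpos.le] at hle
end

section
/- Let M, N ≥ 1 and let γ be a real symmetric positive definite 2(M+1+N)×2(M+1+N) matrix satisfying γ·Ω_{M+1+N}·γ = Ω_{M+1+N} (pure-state condition), with three diagonal blocks corresponding to subsystems A (first 2M rows/columns), B (next 2 rows/columns), and E (last 2N rows/columns). Let γ_{AB}, γ_{BE}, γ_A, γ_E denote the principal submatrices on the indicated index sets. Then it is impossible that both det γ_{AB} < det γ_A and det γ_{BE} < det γ_E hold; i.e., A and E cannot both steer the single-mode system B by Gaussian measurements. -/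
open Matrix ComplexOrder

/-- The single-mode symplectic form `Ω_1 = [[0,1],[-1,0]]`. -/
def Om1 : Matrix (Fin 2) (Fin 2) ℝ := !![0, 1; -1, 0]

theorem Omega_mul_transpose (N : ℕ) : Omega N * (Omega N)ᵀ = 1 := by
  ext i j
  obtain ⟨i, hi⟩ := i
  obtain ⟨j, hj⟩ := j
  rw [Matrix.mul_apply,
    Finset.sum_eq_single (⟨if i % 2 = 0 then i + 1 else i - 1, by grind⟩ : Fin (2 * N))]
  · simp only [Omega, Matrix.transpose_apply, Matrix.of_apply, Matrix.one_apply, Fin.mk.injEq]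
    grind
  · rintro ⟨k, hk⟩ - hki
    simp only [ne_eq, Fin.mk.injEq] at hki
    have hzero : Omega N ⟨i, hi⟩ ⟨k, hk⟩ = 0 := by
      simp only [Omega, Matrix.of_apply]
      grind
    rw [hzero, zero_mul]
  · simp

theorem Om1_mul_transpose : Om1 * Om1ᵀ = 1 := by
  ext i j
  fin_cases i <;> fin_cases j <;> simp [Om1, Matrix.mul_apply]

section Blocks

variable {m n R : Type*} [Fintype m] [Fintype n] [DecidableEq m] [DecidableEq n] [CommRing R]

theorem fromBlocks_diagonal_mul_transpose {J₁ : Matrix m m R} {J₂ : Matrix n n R}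
    (h₁ : J₁ * J₁ᵀ = 1) (h₂ : J₂ * J₂ᵀ = 1) :
    fromBlocks J₁ 0 0 J₂ * (fromBlocks J₁ 0 0 J₂)ᵀ = 1 := by
  simp [fromBlocks_transpose, fromBlocks_multiply, h₁, h₂]

/-- Jacobi's identity for complementary minors of a matrix and its right inverse. -/
theorem det_mul_det_toBlocks₂₂_of_mul_eq_one {G X : Matrix (m ⊕ n) (m ⊕ n) R} (h : G * X = 1) :
    G.det * X.toBlocks₂₂.det = G.toBlocks₁₁.det := by
  have hG := fromBlocks_toBlocks G
  have hX := fromBlocks_toBlocks X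
  rw [← hG, ← hX, fromBlocks_multiply, ← fromBlocks_one, fromBlocks_inj] at h
  obtain ⟨-, h₁₂, -, h₂₂⟩ := h
  have key : G * fromBlocks 1 X.toBlocks₁₂ 0 X.toBlocks₂₂ =
      fromBlocks G.toBlocks₁₁ 0 G.toBlocks₂₁ 1 := by
    conv_lhs => rw [← hG]
    rw [fromBlocks_multiply, h₁₂, h₂₂]
    simp
  simpa using congrArg Matrix.det key

/-- The two complementary diagonal blocks of a real matrix with positive determinant preserving
an orthogonal block-diagonal form have equal determinants. -/
theorem det_toBlocks₁₁_eq_det_toBlocks₂₂ {G : Matrix (m ⊕ n) (m ⊕ n) ℝ}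
    {J₁ : Matrix m m ℝ} {J₂ : Matrix n n ℝ} (h₁ : J₁ * J₁ᵀ = 1) (h₂ : J₂ * J₂ᵀ = 1)
    (hdet : 0 < G.det) (hG : G * fromBlocks J₁ 0 0 J₂ * G = fromBlocks J₁ 0 0 J₂) :
    G.toBlocks₁₁.det = G.toBlocks₂₂.det := by
  have hJ := fromBlocks_diagonal_mul_transpose h₁ h₂
  have hdetJ := congrArg Matrix.det hJ
  rw [det_mul, det_transpose, det_one] at hdetJ
  have hdetG : G.det = 1 := by
    have h := congrArg Matrix.det hG
    rw [det_mul, det_mul] at h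
    have hsq : G.det * G.det = 1 := by
      linear_combination (fromBlocks J₁ 0 0 J₂).det * h + (1 - G.det * G.det) * hdetJ
    nlinarith
  have hdetJ₂ := congrArg Matrix.det h₂
  rw [det_mul, det_transpose, det_one] at hdetJ₂
  have hinv : G * (fromBlocks J₁ 0 0 J₂ * G * (fromBlocks J₁ 0 0 J₂)ᵀ) = 1 := by
    rw [← Matrix.mul_assoc, ← Matrix.mul_assoc, hG, hJ]
  have hblock : (fromBlocks J₁ 0 0 J₂ * G * (fromBlocks J₁ 0 0 J₂)ᵀ).toBlocks₂₂ =
      J₂ * G.toBlocks₂₂ * J₂ᵀ := by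
    conv_lhs => rw [← fromBlocks_toBlocks G]
    simp [fromBlocks_transpose, fromBlocks_multiply]
  rw [← det_mul_det_toBlocks₂₂_of_mul_eq_one hinv, hblock, hdetG, det_mul, det_mul, det_transpose]
  linear_combination G.toBlocks₂₂.det * hdetJ₂

end Blocks

/-- monogamy of Gaussian steering of a single mode for pure states.
If `γ` is the (symmetric positive definite) covariance matrix of a pure
`(M+1+N)`-mode Gaussian state (`γ·Ω·γ = Ω`) with parties `A` (first `2M`
indices), `B` (next `2` indices), `E` (last `2N` indices), then it is impossible
that both `det γ_AB < det γ_A` and `det γ_BE < det γ_E` hold, i.e. `A` and `E`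
cannot both steer the single mode `B`. -/
theorem monogamy_of_pure_state_steering (M N : ℕ) (hM : 1 ≤ M) (hN : 1 ≤ N)
    (γ : Matrix (Fin (2 * M) ⊕ (Fin 2 ⊕ Fin (2 * N)))
        (Fin (2 * M) ⊕ (Fin 2 ⊕ Fin (2 * N))) ℝ)
    (hpd : γ.PosDef) (hsym : γ.IsSymm)
    (hpure : γ * Matrix.fromBlocks (Omega M) 0 0
          (Matrix.fromBlocks Om1 0 0 (Omega N)) * γ =
        Matrix.fromBlocks (Omega M) 0 0 (Matrix.fromBlocks Om1 0 0 (Omega N))) :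
    ¬ ((γ.submatrix (Sum.map id Sum.inl) (Sum.map id Sum.inl)).det <
          (γ.submatrix Sum.inl Sum.inl).det ∧
        (γ.submatrix Sum.inr Sum.inr).det <
          (γ.submatrix (Sum.inr ∘ Sum.inr) (Sum.inr ∘ Sum.inr)).det) := by
  rintro ⟨hAB, hBE⟩
  have hA : (γ.submatrix Sum.inl Sum.inl).det = (γ.submatrix Sum.inr Sum.inr).det :=
    det_toBlocks₁₁_eq_det_toBlocks₂₂ (Omega_mul_transpose M)
      (fromBlocks_diagonal_mul_transpose Om1_mul_transpose (Omega_mul_transpose N))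
      hpd.det_pos hpure
  let e := Equiv.sumAssoc (Fin (2 * M)) (Fin 2) (Fin (2 * N))
  have hform : (fromBlocks (Omega M) 0 0 (fromBlocks Om1 0 0 (Omega N))).submatrix e e =
      fromBlocks (fromBlocks (Omega M) 0 0 Om1) 0 0 (Omega N) := by
    ext ((i | i) | i) ((j | j) | j) <;> rfl
  have hE : (γ.submatrix e e).toBlocks₁₁.det = (γ.submatrix e e).toBlocks₂₂.det := by
    refine det_toBlocks₁₁_eq_det_toBlocks₂₂
      (fromBlocks_diagonal_mul_transpose (Omega_mul_transpose M) Om1_mul_transpose)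
      (Omega_mul_transpose N) ?_ ?_
    · rw [det_submatrix_equiv_self]
      exact hpd.det_pos
    · rw [← hform, submatrix_mul_equiv, submatrix_mul_equiv, hpure]
  have hAB_block : (γ.submatrix e e).toBlocks₁₁ =
      γ.submatrix (Sum.map id Sum.inl) (Sum.map id Sum.inl) := by
    ext (i | i) (j | j) <;> rfl
  have hE_block : (γ.submatrix e e).toBlocks₂₂ =
      γ.submatrix (Sum.inr ∘ Sum.inr) (Sum.inr ∘ Sum.inr) := rfl
  rw [hAB_block, hE_block] at hE
  linarith
end

section
/- Let M, N ≥ 1 and let γ be a real symmetric positive definite (2M+2N)×(2M+2N) matrix such that the complex Hermitian matrix γ + i·(Ω_M ⊕ Ω_N) is positive semidefinite (γ is a valid (M+N)-mode covariance matrix). If the complex Hermitian matrix γ + i·(0_{2M} ⊕ Ω_N) is NOT positive semidefinite (the state is steerable from A to B by Gaussian measurements), then the complex Hermitian matrix γ + i·((−Ω_M) ⊕ Ω_N) is NOT positive semidefinite (the state is NPT, i.e., it has non-positive partial transpose). In other words, any Gaussian state steerable by Gaussian measurements must be an NPT state, confirming the Peres conjecture in the Gaussian steering scenario. -/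
open Matrix ComplexOrder

/-- Positive semidefiniteness of `S + i·Ω` is preserved under taking midpoints in `Ω`. -/
theorem addI_posSemidef_midpoint {n : Type*} {S O₁ O₂ O : Matrix n n ℝ}
    (hO : ∀ i j, O₁ i j + O₂ i j = 2 * O i j)
    (h₁ : (addI S O₁).PosSemidef) (h₂ : (addI S O₂).PosSemidef) :
    (addI S O).PosSemidef := by
  have key : addI S O = (1 / 2 : ℝ) • (addI S O₁ + addI S O₂) := by
    ext i j
    have h : (O₁ i j : ℂ) + O₂ i j = 2 * O i j := by exact_mod_cast hO i j
    simp only [addI, Matrix.add_apply, Matrix.smul_apply, Matrix.map_apply, smul_eq_mul,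
      Complex.real_smul]
    push_cast
    linear_combination (-Complex.I / 2) * h
  rw [key]
  exact (h₁.add h₂).smul (by norm_num)

/-- the Peres conjecture in the Gaussian steering scenario.
If a valid `(M+N)`-mode covariance matrix `γ` (symmetric positive definite,
satisfying `γ + i·(Ω_A ⊕ Ω_B) ≥ 0`) violates the non-steerability condition
`γ + i·(0_A ⊕ Ω_B) ≥ 0` (i.e. is steerable from `A` to `B` by Gaussian
measurements), then it violates the PPT condition `γ + i·((−Ω_A) ⊕ Ω_B) ≥ 0`,
i.e. the state has non-positive partial transpose. -/
theorem steerable_implies_NPT (M N : ℕ) (hM : 1 ≤ M) (hN : 1 ≤ N)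
    (γ : Matrix (Fin (2 * M) ⊕ Fin (2 * N)) (Fin (2 * M) ⊕ Fin (2 * N)) ℝ)
    (hpd : γ.PosDef) (hsym : γ.IsSymm)
    (hcov : (addI γ (Matrix.fromBlocks (Omega M) 0 0 (Omega N))).PosSemidef)
    (hsteer : ¬ (addI γ (Matrix.fromBlocks 0 0 0 (Omega N))).PosSemidef) :
    ¬ (addI γ (Matrix.fromBlocks (-(Omega M)) 0 0 (Omega N))).PosSemidef := by
  intro hppt
  refine hsteer (addI_posSemidef_midpoint ?_ hcov hppt)
  rintro (i | i) (j | j) <;> simp [two_mul]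
end

section
/- Let r > 0 and 0 ≤ η ≤ 1, and let γ' be the 4×4 real matrix with rows (cosh 2r, 0, √η·sinh 2r, 0), (0, cosh 2r, 0, −√η·sinh 2r), (√η·sinh 2r, 0, η·cosh 2r + 1 − η, 0), (0, −√η·sinh 2r, 0, η·cosh 2r + 1 − η), the covariance matrix of a two-mode squeezed vacuum state whose mode B passed through a lossy channel of transmissivity η. Then det γ' < det γ_A (i.e., A can steer B by Gaussian measurements) if and only if η > 0, where γ_A = (cosh 2r)·I_2 is the upper-left 2×2 block. -/
open Matrix Real

/-- Covariance matrix of a two-mode squeezed vacuum state (squeezing `r`)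
whose mode `B` passed through a lossy channel of transmissivity `η`. -/
noncomputable def γloss (r η : ℝ) : Matrix (Fin 4) (Fin 4) ℝ :=
  !![Real.cosh (2 * r), 0, Real.sqrt η * Real.sinh (2 * r), 0;
     0, Real.cosh (2 * r), 0, -(Real.sqrt η * Real.sinh (2 * r));
     Real.sqrt η * Real.sinh (2 * r), 0, η * Real.cosh (2 * r) + 1 - η, 0;
     0, -(Real.sqrt η * Real.sinh (2 * r)), 0, η * Real.cosh (2 * r) + 1 - η]

theorem det_γloss (r : ℝ) {η : ℝ} (hη : 0 ≤ η) :
    (γloss r η).det = (η + (1 - η) * Real.cosh (2 * r)) ^ 2 := by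
  have hdet : (γloss r η).det =
      (Real.cosh (2 * r) * (η * Real.cosh (2 * r) + 1 - η) -
        Real.sqrt η ^ 2 * Real.sinh (2 * r) ^ 2) ^ 2 := by
    simp [γloss, Matrix.det_succ_row_zero, Fin.sum_univ_succ, Fin.succAbove]
    ring
  rw [hdet, Real.sq_sqrt hη, Real.sinh_sq]
  ring

/-- for the lossy-channel state, `A` can steer `B` by Gaussian
measurements (`det γ' < det γ_A` with `γ_A = cosh(2r)·I₂`) iff `η > 0`. -/
theorem lossy_steer_A_to_B_iff (r η : ℝ) (hr : 0 < r) (hη0 : 0 ≤ η) (hη1 : η ≤ 1) :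
    (γloss r η).det <
      (Real.cosh (2 * r) • (1 : Matrix (Fin 2) (Fin 2) ℝ)).det ↔ 0 < η := by
  have hc : 1 < Real.cosh (2 * r) := Real.one_lt_cosh.2 (by positivity)
  have hnonneg : 0 ≤ η + (1 - η) * Real.cosh (2 * r) :=
    add_nonneg hη0 (mul_nonneg (sub_nonneg.2 hη1) (by linarith))
  rw [det_γloss r hη0, Matrix.det_smul, Matrix.det_one, mul_one, Fintype.card_fin,
    sq_lt_sq₀ hnonneg (by linarith), ← sub_pos,
    show Real.cosh (2 * r) - (η + (1 - η) * Real.cosh (2 * r)) =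
      η * (Real.cosh (2 * r) - 1) by ring]
  exact mul_pos_iff_of_pos_right (sub_pos.2 hc)
end

section
/- Let r > 0 and G ≥ 1, and let γ'' be the 4×4 real matrix with rows (cosh 2r, 0, √G·sinh 2r, 0), (0, cosh 2r, 0, −√G·sinh 2r), (√G·sinh 2r, 0, G·cosh 2r + G − 1, 0), (0, −√G·sinh 2r, 0, G·cosh 2r + G − 1), the covariance matrix of a two-mode squeezed vacuum state whose mode B passed through an amplifying channel of gain G. Then det γ'' < det γ_A (i.e., A can steer B by Gaussian measurements) if and only if G < 2·cosh 2r / (cosh 2r + 1), where γ_A = (cosh 2r)·I_2 is the upper-left 2×2 block. -/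
open Matrix Real

/-- Covariance matrix of a two-mode squeezed vacuum state (squeezing `r`)
whose mode `B` passed through an amplifying channel of gain `G`. -/
noncomputable def γamp (r G : ℝ) : Matrix (Fin 4) (Fin 4) ℝ :=
  !![Real.cosh (2 * r), 0, Real.sqrt G * Real.sinh (2 * r), 0;
     0, Real.cosh (2 * r), 0, -(Real.sqrt G * Real.sinh (2 * r));
     Real.sqrt G * Real.sinh (2 * r), 0, G * Real.cosh (2 * r) + G - 1, 0;
     0, -(Real.sqrt G * Real.sinh (2 * r)), 0, G * Real.cosh (2 * r) + G - 1]

/-- for the amplifying-channel state, `A` can steer `B` by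
Gaussian measurements (`det γ'' < det γ_A` with `γ_A = cosh(2r)·I₂`)
iff `G < 2·cosh(2r)/(cosh(2r)+1)`. -/
theorem amp_steer_A_to_B_iff (r G : ℝ) (hr : 0 < r) (hG : 1 ≤ G) :
    (γamp r G).det <
      (Real.cosh (2 * r) • (1 : Matrix (Fin 2) (Fin 2) ℝ)).det ↔
      G < 2 * Real.cosh (2 * r) / (Real.cosh (2 * r) + 1) := by
  have hc : 1 < cosh (2 * r) := one_lt_cosh.2 (by positivity)
  have hs : √G ^ 2 = G := sq_sqrt (by linarith)
  have hcs : sinh (2 * r) ^ 2 = cosh (2 * r) ^ 2 - 1 := sinh_sq (2 * r)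
  have hdet : (γamp r G).det = (G * (cosh (2 * r) + 1) - cosh (2 * r)) ^ 2 := by
    have h : (γamp r G).det = (cosh (2 * r) * (G * cosh (2 * r) + G - 1)
        - √G ^ 2 * sinh (2 * r) ^ 2) ^ 2 := by
      simp [γamp, det_succ_row_zero, Fin.sum_univ_succ, Fin.succAbove]
      ring
    rw [h, hs, hcs]
    ring
  have hpos : 0 ≤ G * (cosh (2 * r) + 1) - cosh (2 * r) := by nlinarith
  rw [hdet, det_smul, det_one, Fintype.card_fin, mul_one,
    pow_lt_pow_iff_left₀ hpos (by linarith) two_ne_zero, lt_div_iff₀ (by linarith)]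
  constructor <;> intro h <;> linarith
end

section
/- Let r > 0 and G ≥ 1, and let γ'' be the 4×4 real matrix with rows (cosh 2r, 0, √G·sinh 2r, 0), (0, cosh 2r, 0, −√G·sinh 2r), (√G·sinh 2r, 0, G·cosh 2r + G − 1, 0), (0, −√G·sinh 2r, 0, G·cosh 2r + G − 1), the covariance matrix of a two-mode squeezed vacuum state whose mode B passed through an amplifying channel of gain G. Then det γ'' < det γ_B, where γ_B = (G·cosh 2r + G − 1)·I_2 is the lower-right 2×2 block; i.e., it is always possible to steer from B to A by Gaussian measurements. -/
open Matrix Real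

/-- The determinant of `γ''` is the square of `G + (G - 1) cosh 2r`. -/
theorem det_γamp {r G : ℝ} (hG : 0 ≤ G) :
    (γamp r G).det = (G + (G - 1) * Real.cosh (2 * r)) ^ 2 := by
  have hblock : (γamp r G).det =
      (Real.cosh (2 * r) * (G * Real.cosh (2 * r) + G - 1) -
        Real.sqrt G ^ 2 * Real.sinh (2 * r) ^ 2) ^ 2 := by
    simp [γamp, Matrix.det_succ_row_zero, Fin.sum_univ_succ, Fin.succAbove]
    ring
  rw [hblock, Real.sq_sqrt hG, Real.sinh_sq]
  ring

/-- for the amplifying-channel state, `B` can always steer `A`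
by Gaussian measurements: `det γ'' < det γ_B` with
`γ_B = (G·cosh(2r)+G−1)·I₂`. -/
theorem amp_steer_B_to_A (r G : ℝ) (hr : 0 < r) (hG : 1 ≤ G) :
    (γamp r G).det <
      ((G * Real.cosh (2 * r) + G - 1) • (1 : Matrix (Fin 2) (Fin 2) ℝ)).det := by
  have hc : 1 < Real.cosh (2 * r) := Real.one_lt_cosh.2 (by positivity)
  have hpos : 0 ≤ (G - 1) * Real.cosh (2 * r) :=
    mul_nonneg (by linarith) (by linarith)
  rw [det_γamp (by linarith), Matrix.det_smul, Matrix.det_one, mul_one, Fintype.card_fin]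
  exact pow_lt_pow_left₀ (by linarith) (by linarith) two_ne_zero
end

section
/- Let a, b, c₁, c₂ be real numbers with a ≥ 1, b ≥ 1, and a²·(b − 1)² ≥ (c₁² + c₂²)²/4. Then (b² + 1 − (c₁² + c₂²)²/(4(a² + 1))) · (b² + 1 − c₁²·c₂²/(a² + 1)) ≥ 4·b². (This is the Reid-type non-steerability inequality for the second-order quadratures X⁽²⁾, P⁽²⁾ of a two-mode Gaussian state in standard form: if the state is non-steerable by Gaussian measurements, it also satisfies the Reid criterion for Hillery's second-order squeezing measurements.) -/
/-- the Reid-type non-steerability inequality for the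
second-order quadratures `X⁽²⁾, P⁽²⁾` of a two-mode Gaussian state in
standard form follows from the condition `a²(b−1)² ≥ (c₁² + c₂²)²/4`. -/
theorem reid_second_order_criterion (a b c₁ c₂ : ℝ)
    (ha : 1 ≤ a) (hb : 1 ≤ b)
    (h : (c₁ ^ 2 + c₂ ^ 2) ^ 2 / 4 ≤ a ^ 2 * (b - 1) ^ 2) :
    4 * b ^ 2 ≤
      (b ^ 2 + 1 - (c₁ ^ 2 + c₂ ^ 2) ^ 2 / (4 * (a ^ 2 + 1))) *
      (b ^ 2 + 1 - c₁ ^ 2 * c₂ ^ 2 / (a ^ 2 + 1)) := by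
  have h₁ : (c₁ ^ 2 + c₂ ^ 2) ^ 2 / (4 * (a ^ 2 + 1)) ≤ (b - 1) ^ 2 := by
    rw [div_le_iff₀ (by positivity)]
    nlinarith [sq_nonneg (b - 1)]
  have h₂ : c₁ ^ 2 * c₂ ^ 2 / (a ^ 2 + 1) ≤ (b - 1) ^ 2 := by
    rw [div_le_iff₀ (by positivity)]
    nlinarith [sq_nonneg (b - 1), sq_nonneg (c₁ ^ 2 - c₂ ^ 2)]
  calc 4 * b ^ 2 = (2 * b) * (2 * b) := by ring
    _ ≤ _ := mul_le_mul (by linarith) (by linarith) (by linarith) (by linarith)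
end

section
/- Let A, B, C, D be real numbers with A ≥ 0, B ≥ 0, C·D ≤ 0, and A·B ≥ (C² + D²) − B/2, and let N ≥ 1 be a natural number. If B^N·((A+1)^N + A^N) ≥ 2·(C^N + (−1)^N·D^N)², then B^(N+1)·((A+1)^(N+1) + A^(N+1)) ≥ 2·(C^(N+1) + (−1)^(N+1)·D^(N+1))². -/
/-- the induction step for the higher-order Reid
non-steerability estimate. If `A·B ≥ (C² + D²) − B/2` (non-steerability by
Gaussian measurements) with `A, B ≥ 0` and `C·D ≤ 0`, then the estimate
`Bᴺ((A+1)ᴺ + Aᴺ) ≥ 2(Cᴺ + (−1)ᴺDᴺ)²` for `N` implies the same estimate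
for `N + 1`. -/
theorem higher_order_induction_step (A B C D : ℝ)
    (hA : 0 ≤ A) (hB : 0 ≤ B) (hCD : C * D ≤ 0)
    (hns : (C ^ 2 + D ^ 2) - B / 2 ≤ A * B)
    (N : ℕ) (hN : 1 ≤ N)
    (hind : 2 * (C ^ N + (-1 : ℝ) ^ N * D ^ N) ^ 2 ≤
      B ^ N * ((A + 1) ^ N + A ^ N)) :
    2 * (C ^ (N + 1) + (-1 : ℝ) ^ (N + 1) * D ^ (N + 1)) ^ 2 ≤
      B ^ (N + 1) * ((A + 1) ^ (N + 1) + A ^ (N + 1)) := by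
  have hxy : 0 ≤ C ^ N * ((-1 : ℝ) ^ N * D ^ N) := by
    rw [← mul_pow, ← mul_pow]
    exact pow_nonneg (by linarith) N
  have hmono : A ^ N ≤ (A + 1) ^ N := pow_le_pow_left₀ hA (by linarith) N
  have hBN : 0 ≤ B ^ N := pow_nonneg hB N
  set x := C ^ N with hx
  set y := (-1 : ℝ) ^ N * D ^ N with hy
  have hsum : C ^ (N + 1) + (-1 : ℝ) ^ (N + 1) * D ^ (N + 1) = C * x - D * y := by
    rw [hx, hy]; ring
  have hcoef : 0 ≤ C ^ 2 + D ^ 2 + C * D := by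
    nlinarith [sq_nonneg (C + D), sq_nonneg C, sq_nonneg D]
  have hcauchy : (C * x - D * y) ^ 2 ≤ (C ^ 2 + D ^ 2) * (x + y) ^ 2 := by
    have h : (C ^ 2 + D ^ 2) * (x + y) ^ 2 - (C * x - D * y) ^ 2 =
        (C * y) ^ 2 + (D * x) ^ 2 + 2 * (x * y * (C ^ 2 + D ^ 2 + C * D)) := by ring
    linarith [sq_nonneg (C * y), sq_nonneg (D * x), mul_nonneg hxy hcoef]
  rw [hsum]
  calc 2 * (C * x - D * y) ^ 2
      ≤ (C ^ 2 + D ^ 2) * (2 * (x + y) ^ 2) := by linarith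
    _ ≤ (B * (A + 1 / 2)) * (B ^ N * ((A + 1) ^ N + A ^ N)) :=
        mul_le_mul (by linarith) hind (by positivity) (by positivity)
    _ ≤ B ^ (N + 1) * ((A + 1) ^ (N + 1) + A ^ (N + 1)) := by
        have h : B ^ (N + 1) * ((A + 1) ^ (N + 1) + A ^ (N + 1)) -
            (B * (A + 1 / 2)) * (B ^ N * ((A + 1) ^ N + A ^ N)) =
            B * B ^ N * ((A + 1) ^ N - A ^ N) / 2 := by ring
        linarith [mul_nonneg (mul_nonneg hB hBN) (sub_nonneg.2 hmono)]
end

section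
/- Let A, B, C, D be real numbers with A ≥ 0, B ≥ 0, C ≥ 0, D ≤ 0, A·B ≥ (C² + D²) − B/2, and B·(2A + 1) ≥ 2·(C − D)². Then for every natural number N ≥ 1, both B^N·((A+1)^N + A^N) ≥ 2·(C^N + (−1)^N·D^N)² and B^N·((A+1)^N + A^N) ≥ 2·(C^N + (−1)^(N+1)·D^N)² hold. (Consequently, a two-mode Gaussian state that is non-steerable by Gaussian measurements satisfies the Reid non-steerability criterion for the higher-order quadrature measurements X⁽ᴺ⁾, P⁽ᴺ⁾ of every order N ≥ 2.) -/
/-- Since `2 (c + d) ^ 2 ≤ b (x + y)`, superadditivity of `t ↦ t ^ n` on the left and its convexity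
on the right give the corresponding bound for `n`-th powers. -/
theorem two_mul_pow_add_pow_sq_le {b c d x y : ℝ} (hb : 0 ≤ b) (hc : 0 ≤ c) (hd : 0 ≤ d)
    (hx : 0 ≤ x) (hy : 0 ≤ y) (h : 2 * (c + d) ^ 2 ≤ b * (x + y)) {n : ℕ} (hn : n ≠ 0) :
    2 * (c ^ n + d ^ n) ^ 2 ≤ b ^ n * (x ^ n + y ^ n) := by
  have hsuper : (c ^ n + d ^ n) ^ 2 ≤ ((c + d) ^ n) ^ 2 := by
    gcongr
    exact pow_add_pow_le hc hd hn
  have hconv : (x + y) ^ n ≤ 2 ^ (n - 1) * (x ^ n + y ^ n) := add_pow_le hx hy n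
  have htwo : (2 : ℝ) ^ n = 2 ^ (n - 1) * 2 := (pow_sub_one_mul hn 2).symm
  refine le_of_mul_le_mul_left ?_ (by positivity : (0 : ℝ) < 2 ^ (n - 1))
  calc (2 : ℝ) ^ (n - 1) * (2 * (c ^ n + d ^ n) ^ 2)
      = 2 ^ n * (c ^ n + d ^ n) ^ 2 := by rw [htwo]; ring
    _ ≤ 2 ^ n * ((c + d) ^ n) ^ 2 := by gcongr
    _ = (2 * (c + d) ^ 2) ^ n := by rw [mul_pow, pow_right_comm]
    _ ≤ (b * (x + y)) ^ n := by gcongr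
    _ = b ^ n * (x + y) ^ n := mul_pow ..
    _ ≤ b ^ n * (2 ^ (n - 1) * (x ^ n + y ^ n)) := by gcongr
    _ = 2 ^ (n - 1) * (b ^ n * (x ^ n + y ^ n)) := by ring


/-- the higher-order Reid non-steerability estimates of all
orders. If `A, B, C ≥ 0`, `D ≤ 0`, the Gaussian non-steerability condition
`A·B ≥ (C² + D²) − B/2` holds, and the base case `B(2A+1) ≥ 2(C−D)²` holds,
then for every `N ≥ 1` both `Bᴺ((A+1)ᴺ + Aᴺ) ≥ 2(Cᴺ + (−1)ᴺDᴺ)²` and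
`Bᴺ((A+1)ᴺ + Aᴺ) ≥ 2(Cᴺ + (−1)^(N+1)Dᴺ)²` hold. -/
theorem higher_order_reid_all_orders (A B C D : ℝ)
    (hA : 0 ≤ A) (hB : 0 ≤ B) (hC : 0 ≤ C) (hD : D ≤ 0)
    (hns : (C ^ 2 + D ^ 2) - B / 2 ≤ A * B)
    (hbase : 2 * (C - D) ^ 2 ≤ B * (2 * A + 1)) :
    ∀ N : ℕ, 1 ≤ N →
      2 * (C ^ N + (-1 : ℝ) ^ N * D ^ N) ^ 2 ≤
          B ^ N * ((A + 1) ^ N + A ^ N) ∧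
      2 * (C ^ N + (-1 : ℝ) ^ (N + 1) * D ^ N) ^ 2 ≤
          B ^ N * ((A + 1) ^ N + A ^ N) := by
  intro N hN
  have hE : 0 ≤ -D := neg_nonneg.mpr hD
  have hsum : 2 * (C ^ N + (-D) ^ N) ^ 2 ≤ B ^ N * ((A + 1) ^ N + A ^ N) :=
    two_mul_pow_add_pow_sq_le hB hC hE (by positivity) hA (by linarith) (by lia)
  have hpow : (-1 : ℝ) ^ N * D ^ N = (-D) ^ N := (neg_pow D N).symm
  rw [pow_succ (-1 : ℝ) N, mul_neg_one, neg_mul, hpow]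
  refine ⟨hsum, le_trans ?_ hsum⟩
  have := mul_nonneg (pow_nonneg hC N) (pow_nonneg hE N)
  linarith
end
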